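/- arXiv:2602.10506 — 2 statements merged into one kernel-verified Lean document; each statement's English description precedes it below -/
import Mathlib

section
/- (Weighted score representation; the equality LE = RE concluding the proof of Theorem 1.) For every x ∈ ℝ^d, the target score equals the importance-weighted posterior average of the conditional transition score: ∇ log q_t(x) = ( ∫ (q₀(x₀)/p₀(x₀)) · ∇_x log k(x₀, x) · p(x₀ | x) dx₀ ) / ( ∫ (q₀(x₀)/p₀(x₀)) · p(x₀ | x) dx₀ ). -/
open MeasureTheory

noncomputable section

/-- `ℝ^d` with its Euclidean structure. -/
abbrev Euc (d : ℕ) := EuclideanSpace ℝ (Fin d)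

open scoped Gradient in
/-- The gradient of the logarithm of a positive function. Differentiability is not needed: `f` and
`log f` are differentiable at the same points, and elsewhere both gradients are zero. -/
theorem gradient_log_of_pos {F : Type*} [NormedAddCommGroup F] [InnerProductSpace ℝ F]
    [CompleteSpace F] {f : F → ℝ} (hf : ∀ y, 0 < f y) (x : F) :
    ∇ (fun y => Real.log (f y)) x = (f x)⁻¹ • ∇ f x := by
  by_cases h : DifferentiableAt ℝ f x
  · simp [gradient, fderiv.log h (hf x).ne']
  · have hlog : ¬DifferentiableAt ℝ (fun y => Real.log (f y)) x := fun hl =>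
      h (by simpa only [Real.exp_log (hf _)] using hl.exp)
    rw [gradient_eq_zero_of_not_differentiableAt h,
      gradient_eq_zero_of_not_differentiableAt hlog, smul_zero]

/-- The integral of an everywhere positive integrable function is positive. -/
theorem integral_pos_of_forall_pos {α : Type*} [MeasurableSpace α] {μ : Measure α} [NeZero μ]
    {f : α → ℝ} (hf : ∀ a, 0 < f a) (hint : Integrable f μ) : 0 < ∫ a, f a ∂μ := by
  rw [integral_pos_iff_support_of_nonneg (fun a => (hf a).le) hint,
    Function.support_eq_univ fun a => (hf a).ne']
  exact NeZero.pos _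

/-- **Weighted score representation (LE = RE in the proof of Theorem 1).**
For every `x ∈ ℝ^d`, the target score equals the importance-weighted posterior average
of the conditional transition score:
`∇ log q_t(x) = (∫ (q₀(x₀)/p₀(x₀)) ∇_x log k(x₀,x) p(x₀|x) dx₀) /
                (∫ (q₀(x₀)/p₀(x₀)) p(x₀|x) dx₀)`,
where `p_t(x) = ∫ k(x₀,x) p₀(x₀) dx₀`, `q_t(x) = ∫ k(x₀,x) q₀(x₀) dx₀`,
`p(x₀ | x) = k(x₀,x) p₀(x₀) / p_t(x)`, and differentiation under the integral sign is
assumed valid. -/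
theorem target_score_weighted_representation
    (d : ℕ) (hd : 0 < d)
    (p₀ q₀ : Euc d → ℝ) (k : Euc d → Euc d → ℝ) (pt qt : Euc d → ℝ)
    (hp₀pos : ∀ x₀, 0 < p₀ x₀) (hq₀pos : ∀ x₀, 0 < q₀ x₀)
    (hp₀meas : Measurable p₀) (hq₀meas : Measurable q₀)
    (hp₀prob : ∫ x₀, p₀ x₀ = 1) (hq₀prob : ∫ x₀, q₀ x₀ = 1)
    (hkpos : ∀ x₀ x, 0 < k x₀ x)
    (hkmeas : Measurable (Function.uncurry k))
    (hkprob : ∀ x₀, ∫ x, k x₀ x = 1)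
    (hkdiff : ∀ x₀, Differentiable ℝ fun x => k x₀ x)
    (hpt_int : ∀ x, Integrable fun x₀ => k x₀ x * p₀ x₀)
    (hqt_int : ∀ x, Integrable fun x₀ => k x₀ x * q₀ x₀)
    (hpt : ∀ x, pt x = ∫ x₀, k x₀ x * p₀ x₀)
    (hqt : ∀ x, qt x = ∫ x₀, k x₀ x * q₀ x₀)
    (hpt_grad : ∀ x, gradient pt x = ∫ x₀, p₀ x₀ • gradient (fun y => k x₀ y) x)
    (hqt_grad : ∀ x, gradient qt x = ∫ x₀, q₀ x₀ • gradient (fun y => k x₀ y) x) :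
    ∀ x, gradient (fun y => Real.log (qt y)) x
      = (∫ x₀, (q₀ x₀ / p₀ x₀) * (k x₀ x * p₀ x₀ / pt x))⁻¹ •
          ∫ x₀, ((q₀ x₀ / p₀ x₀) * (k x₀ x * p₀ x₀ / pt x)) •
            gradient (fun y => Real.log (k x₀ y)) x := by
  have hpt_pos : ∀ x, 0 < pt x := fun x => by
    rw [hpt]
    exact integral_pos_of_forall_pos (fun x₀ => mul_pos (hkpos x₀ x) (hp₀pos x₀)) (hpt_int x)
  have hqt_pos : ∀ x, 0 < qt x := fun x => by
    rw [hqt]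
    exact integral_pos_of_forall_pos (fun x₀ => mul_pos (hkpos x₀ x) (hq₀pos x₀)) (hqt_int x)
  intro x
  have hweight : ∀ x₀, q₀ x₀ / p₀ x₀ * (k x₀ x * p₀ x₀ / pt x) =
      (pt x)⁻¹ * (k x₀ x * q₀ x₀) := fun x₀ => by
    have := (hp₀pos x₀).ne'
    field_simp
  have hscore : ∀ x₀, ((pt x)⁻¹ * (k x₀ x * q₀ x₀)) •
      gradient (fun y => Real.log (k x₀ y)) x =
        (pt x)⁻¹ • q₀ x₀ • gradient (fun y => k x₀ y) x := fun x₀ => by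
    have := (hkpos x₀ x).ne'
    rw [gradient_log_of_pos (hkpos x₀), smul_smul, smul_smul]
    congr 1
    field_simp
  simp_rw [hweight, hscore]
  rw [integral_const_mul, integral_smul, ← hqt, ← hqt_grad, gradient_log_of_pos hqt_pos, smul_smul]
  congr 1
  have := (hpt_pos x).ne'
  have := (hqt_pos x).ne'
  field_simp
end
end

section
/- (Denoising score matching equivalence on the source domain.) There exists a constant C ∈ ℝ, independent of s, such that for every measurable vector field s : ℝ^d → ℝ^d satisfying ∫ ‖s(x)‖² p_t(x) dx < ∞, one has ∫ ‖s(x) − ∇ log p_t(x)‖² p_t(x) dx = ∫∫ ‖s(x) − ∇_x log k(x₀, x)‖² k(x₀, x) p₀(x₀) dx₀ dx + C. In particular the two objectives have the same minimizers over such vector fields s. -/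
open MeasureTheory

noncomputable section

section Gradient

variable {E : Type*} [NormedAddCommGroup E] [InnerProductSpace ℝ E]

/-- The gradient of `log ∘ f` for positive `f`, without assuming differentiability. -/
theorem gradient_log_comp [CompleteSpace E] {f : E → ℝ} (hf : ∀ x, 0 < f x) (x : E) :
    gradient (fun y => Real.log (f y)) x = (f x)⁻¹ • gradient f x := by
  by_cases h : DifferentiableAt ℝ f x
  · simp only [gradient, fderiv.log h (hf x).ne', map_smul]
  · have h' : ¬ DifferentiableAt ℝ (fun y => Real.log (f y)) x := fun hl =>
      h (by simpa only [Real.exp_log (hf _)] using hl.exp)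
    simp [gradient, fderiv_zero_of_not_differentiableAt h, fderiv_zero_of_not_differentiableAt h']

/-- The partial gradient of a jointly measurable function that is differentiable in its second
variable is jointly measurable. -/
theorem measurable_gradient_with_param [FiniteDimensional ℝ E] [MeasurableSpace E] [BorelSpace E]
    {α : Type*} [MeasurableSpace α] {f : α → E → ℝ} (hf : Measurable (Function.uncurry f))
    (hdiff : ∀ a, Differentiable ℝ (f a)) :
    Measurable fun z : α × E => gradient (f z.1) z.2 := by
  have hdir : ∀ v : E, Measurable fun z : α × E => fderiv ℝ (f z.1) z.2 v := by
    intro v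
    refine measurable_of_tendsto_metrizable
      (f := fun (n : ℕ) (z : α × E) => (n : ℝ) • (f z.1 (z.2 + (n : ℝ)⁻¹ • v) - f z.1 z.2))
      (fun n => ?_) (tendsto_pi_nhds.2 fun z => ?_)
    · have h : Measurable fun z : α × E => f z.1 (z.2 + (n : ℝ)⁻¹ • v) :=
        hf.comp (measurable_fst.prodMk (measurable_snd.add_const _))
      exact (h.sub hf).const_smul (n : ℝ)
    · exact (hdiff z.1 z.2).hasFDerivAt.lim v
        (tendsto_norm_atTop_atTop.comp tendsto_natCast_atTop_atTop)
  have hsum : (fun z : α × E => gradient (f z.1) z.2) = fun z =>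
      ∑ i, (fderiv ℝ (f z.1) z.2 (stdOrthonormalBasis ℝ E i)) • stdOrthonormalBasis ℝ E i := by
    funext z
    rw [← (stdOrthonormalBasis ℝ E).sum_repr' (gradient (f z.1) z.2)]
    refine Finset.sum_congr rfl fun i _ => ?_
    rw [real_inner_comm, gradient, InnerProductSpace.toDual_symm_apply]
  rw [hsum]
  exact Finset.measurable_sum _ fun i _ => (hdir _).smul_const _

end Gradient

section WeightedSquare

variable {α E : Type*} [MeasurableSpace α] {μ : Measure α}
  [NormedAddCommGroup E] [InnerProductSpace ℝ E]

/-- A vector field that is square integrable against an integrable weight is integrable against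
that weight. -/
theorem integrable_smul_of_integrable_norm_sq_mul {w : α → ℝ} {b : α → E}
    (hw : Integrable w μ) (hw0 : ∀ a, 0 ≤ w a) (hb : AEStronglyMeasurable b μ)
    (hb2 : Integrable (fun a => ‖b a‖ ^ 2 * w a) μ) :
    Integrable (fun a => w a • b a) μ := by
  refine (hb2.add hw).mono' (hw.aestronglyMeasurable.smul hb) (.of_forall fun a => ?_)
  rw [norm_smul, Real.norm_of_nonneg (hw0 a), Pi.add_apply]
  nlinarith [mul_nonneg (hw0 a) (sq_nonneg (‖b a‖ - 1)), mul_nonneg (hw0 a) (sq_nonneg ‖b a‖),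
    hw0 a]

/-- The bias-variance decomposition of a weighted square distance to a fixed vector, where `m` is
the weighted mean of `b`. -/
theorem integral_norm_sub_sq_mul [CompleteSpace E] {w : α → ℝ} {b : α → E} {m : E}
    (hw : Integrable w μ) (hb : Integrable (fun a => w a • b a) μ)
    (hb2 : Integrable (fun a => ‖b a‖ ^ 2 * w a) μ)
    (hm : (∫ a, w a ∂μ) • m = ∫ a, w a • b a ∂μ) (v : E) :
    ∫ a, ‖v - b a‖ ^ 2 * w a ∂μ =
      ‖v - m‖ ^ 2 * (∫ a, w a ∂μ) + (∫ a, ‖b a‖ ^ 2 * w a ∂μ) - ‖m‖ ^ 2 * ∫ a, w a ∂μ := by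
  have hexp : ∀ a, ‖v - b a‖ ^ 2 * w a =
      ‖v‖ ^ 2 * w a - 2 * inner ℝ v (w a • b a) + ‖b a‖ ^ 2 * w a := fun a => by
    rw [norm_sub_sq_real, real_inner_smul_right]
    ring
  have hinner : Integrable (fun a => 2 * inner ℝ v (w a • b a)) μ :=
    (hb.const_inner v).const_mul 2
  simp only [hexp]
  have hlin : Integrable (fun a => ‖v‖ ^ 2 * w a - 2 * inner ℝ v (w a • b a)) μ :=
    (hw.const_mul _).sub hinner
  rw [integral_add hlin hb2, integral_sub (hw.const_mul _) hinner,
    integral_const_mul, integral_const_mul, integral_inner hb, ← hm, real_inner_smul_right,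
    norm_sub_sq_real]
  ring

/-- Square integrability against a nonnegative weight is stable under differences. -/
theorem integrable_norm_sub_sq_mul {w : α → ℝ} {f g : α → E}
    (hw : AEStronglyMeasurable w μ) (hw0 : ∀ a, 0 ≤ w a)
    (hf : AEStronglyMeasurable f μ) (hg : AEStronglyMeasurable g μ)
    (hf2 : Integrable (fun a => ‖f a‖ ^ 2 * w a) μ)
    (hg2 : Integrable (fun a => ‖g a‖ ^ 2 * w a) μ) :
    Integrable (fun a => ‖f a - g a‖ ^ 2 * w a) μ := by
  refine ((hf2.add hg2).const_mul 2).mono' (((hf.sub hg).norm.pow 2).mul hw)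
    (.of_forall fun a => ?_)
  rw [Real.norm_of_nonneg (mul_nonneg (sq_nonneg _) (hw0 a)), Pi.add_apply, ← add_mul,
    ← mul_assoc]
  refine mul_le_mul_of_nonneg_right ?_ (hw0 a)
  nlinarith [parallelogram_law_with_norm ℝ (f a) (g a), sq_nonneg ‖f a + g a‖]

end WeightedSquare

/-- **Denoising score matching equivalence on the source domain.**
There exists a constant `C ∈ ℝ`, independent of `s`, such that for every measurable
vector field `s : ℝ^d → ℝ^d` with `∫ ‖s(x)‖² p_t(x) dx < ∞`,
`∫ ‖s(x) − ∇ log p_t(x)‖² p_t(x) dx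
  = ∫∫ ‖s(x) − ∇_x log k(x₀,x)‖² k(x₀,x) p₀(x₀) dx₀ dx + C`.
Here `p_t(x) = ∫ k(x₀,x) p₀(x₀) dx₀`, differentiation under the integral sign is assumed
valid, and both reference objectives are assumed finite. In particular the two objectives
have the same minimizers over such vector fields `s`. -/
theorem denoising_score_matching_equivalence
    (d : ℕ) (hd : 0 < d)
    (p₀ : Euc d → ℝ) (k : Euc d → Euc d → ℝ) (pt : Euc d → ℝ)
    (hp₀pos : ∀ x₀, 0 < p₀ x₀)
    (hp₀meas : Measurable p₀)
    (hp₀prob : ∫ x₀, p₀ x₀ = 1)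
    (hkpos : ∀ x₀ x, 0 < k x₀ x)
    (hkmeas : Measurable (Function.uncurry k))
    (hkprob : ∀ x₀, ∫ x, k x₀ x = 1)
    (hkdiff : ∀ x₀, Differentiable ℝ fun x => k x₀ x)
    (hpt_int : ∀ x, Integrable fun x₀ => k x₀ x * p₀ x₀)
    (hpt : ∀ x, pt x = ∫ x₀, k x₀ x * p₀ x₀)
    (hpt_grad : ∀ x, gradient pt x = ∫ x₀, p₀ x₀ • gradient (fun y => k x₀ y) x)
    (hscore_sq_int :
      Integrable fun x => ‖gradient (fun y => Real.log (pt y)) x‖ ^ 2 * pt x)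
    (hcond_sq_int :
      Integrable fun z : Euc d × Euc d =>
        ‖gradient (fun y => Real.log (k z.1 y)) z.2‖ ^ 2 * (k z.1 z.2 * p₀ z.1)) :
    ∃ C : ℝ, ∀ s : Euc d → Euc d, Measurable s →
      Integrable (fun x => ‖s x‖ ^ 2 * pt x) →
      ∫ x, ‖s x - gradient (fun y => Real.log (pt y)) x‖ ^ 2 * pt x
        = (∫ x, ∫ x₀,
            ‖s x - gradient (fun y => Real.log (k x₀ y)) x‖ ^ 2 * (k x₀ x * p₀ x₀)) + C := by
  have hw0 : ∀ x₀ x, 0 < k x₀ x * p₀ x₀ := fun x₀ x => mul_pos (hkpos x₀ x) (hp₀pos x₀)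
  have hptpos : ∀ x, 0 < pt x := fun x => by
    rw [hpt, integral_pos_iff_support_of_nonneg (fun x₀ => (hw0 x₀ x).le) (hpt_int x),
      Function.support_eq_univ fun x₀ => (hw0 x₀ x).ne']
    exact Measure.measure_univ_pos.2 (NeZero.ne _)
  have hgrad := measurable_gradient_with_param hkmeas hkdiff
  have hscore := gradient_log_comp hptpos
  have hcond := fun x₀ => gradient_log_comp (hkpos x₀)
  have hb : Measurable fun z : Euc d × Euc d => gradient (fun y => Real.log (k z.1 y)) z.2 := by
    simp only [hcond]
    exact hkmeas.inv.smul hgrad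
  have hptmeas : StronglyMeasurable pt := by
    rw [funext hpt]
    exact (hkmeas.mul (hp₀meas.comp measurable_fst)).stronglyMeasurable.integral_prod_left'
  have hptgrad : StronglyMeasurable (gradient pt) := by
    rw [funext hpt_grad]
    exact ((hp₀meas.comp measurable_fst).smul hgrad).stronglyMeasurable.integral_prod_left'
  have ha : StronglyMeasurable fun x => gradient (fun y => Real.log (pt y)) x := by
    simp only [hscore]
    exact (hptmeas.measurable.inv.smul hptgrad.measurable).stronglyMeasurable
  have hmean : ∀ x, (∫ x₀, k x₀ x * p₀ x₀) • gradient (fun y => Real.log (pt y)) x =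
      ∫ x₀, (k x₀ x * p₀ x₀) • gradient (fun y => Real.log (k x₀ y)) x := fun x => by
    rw [← hpt, hscore, smul_inv_smul₀ (hptpos x).ne', hpt_grad]
    refine integral_congr_ae (.of_forall fun x₀ => ?_)
    simp only [hcond]
    rw [mul_comm, mul_smul, smul_inv_smul₀ (hkpos x₀ x).ne']
  rw [Measure.volume_eq_prod] at hcond_sq_int
  have hB := hcond_sq_int.integral_prod_right
  refine ⟨(∫ x, ‖gradient (fun y => Real.log (pt y)) x‖ ^ 2 * pt x) -
    ∫ x, ∫ x₀, ‖gradient (fun y => Real.log (k x₀ y)) x‖ ^ 2 * (k x₀ x * p₀ x₀),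
    fun s hs hs2 => ?_⟩
  have hS := integrable_norm_sub_sq_mul hptmeas.aestronglyMeasurable (fun x => (hptpos x).le)
    hs.aestronglyMeasurable ha.aestronglyMeasurable hs2 hscore_sq_int
  have hdecomp : ∀ᵐ x, ∫ x₀,
      ‖s x - gradient (fun y => Real.log (k x₀ y)) x‖ ^ 2 * (k x₀ x * p₀ x₀) =
      ‖s x - gradient (fun y => Real.log (pt y)) x‖ ^ 2 * pt x +
      (∫ x₀, ‖gradient (fun y => Real.log (k x₀ y)) x‖ ^ 2 * (k x₀ x * p₀ x₀)) -
      ‖gradient (fun y => Real.log (pt y)) x‖ ^ 2 * pt x := by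
    filter_upwards [hcond_sq_int.prod_left_ae] with x hx
    rw [hpt x]
    exact integral_norm_sub_sq_mul (hpt_int x)
      (integrable_smul_of_integrable_norm_sq_mul (hpt_int x) (fun x₀ => (hw0 x₀ x).le)
        (hb.comp measurable_prodMk_right).aestronglyMeasurable hx) hx (hmean x) (s x)
  have hSB : Integrable fun x =>
      ‖s x - gradient (fun y => Real.log (pt y)) x‖ ^ 2 * pt x +
      ∫ x₀, ‖gradient (fun y => Real.log (k x₀ y)) x‖ ^ 2 * (k x₀ x * p₀ x₀) := hS.add hB
  rw [integral_congr_ae hdecomp, integral_sub hSB hscore_sq_int, integral_add hS hB]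
  ring
end
end
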